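/- Let A be a commutative Noetherian local Gorenstein ring, M a finitely generated A-module of finite injective dimension, and P a prime ideal in the support of M. Then the Bass numbers satisfy μ^i(P,M) ≠ 0 if and only if depth(M_P) ≤ i ≤ injdim(M_P). -/

import Mathlib

open CategoryTheory

/-- The `i`-th Ext group of two modules over a commutative ring, as a module. -/
noncomputable def extMod (A : Type) [CommRing A] (i : ℕ) (M N : Type) [AddCommGroup M]
    [Module A M] [AddCommGroup N] [Module A N] : ModuleCat A :=
  ((Ext A (ModuleCat A) i).obj (Opposite.op (ModuleCat.of A M))).obj (ModuleCat.of A N)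

/-- The injective dimension of a module, as an extended natural number, characterized by
vanishing of `Ext^i(—, M)` for `i` beyond it. -/
noncomputable def injDim (A : Type) [CommRing A] (M : Type) [AddCommGroup M]
    [Module A M] : ℕ∞ :=
  sInf { n : ℕ∞ | ∀ (X : Type) (_ : AddCommGroup X) (_ : Module A X) (i : ℕ),
    n < i → Subsingleton (extMod A i X M) }

/-- The depth of a module `M` over a local ring `A` with residue field `k`:
`inf { i | Ext^i_A(k, M) ≠ 0 }`. -/
noncomputable def depthLocal (A : Type) [CommRing A] [IsLocalRing A] (M : Type)
    [AddCommGroup M] [Module A M] : ℕ∞ :=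
  sInf { i : ℕ∞ | ∃ j : ℕ, i = j ∧ Nontrivial (extMod A j (IsLocalRing.ResidueField A) M) }

theorem subs_homology_iff {A : Type} [CommRing A] (K : CochainComplex (ModuleCat.{0} A) ℕ) (n : ℕ) :
    Subsingleton (K.homology n) ↔ ∀ f : K.X n, (K.d n (n+1)).hom f = 0 → 
      ∃ g, (K.d ((ComplexShape.up ℕ).prev n) n).hom g = f := by
  rw [← ModuleCat.isZero_iff_subsingleton, ← HomologicalComplex.exactAt_iff_isZero_homology,
   HomologicalComplex.exactAt_iff' K _ n (n+1) rfl (by simp), ShortComplex.moduleCat_exact_iff]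
  rfl

theorem bridge (A : Type) [CommRing A] (i : ℕ) (M N : Type) [AddCommGroup M]
    [Module A M] [AddCommGroup N] [Module A N] :
    Subsingleton (extMod A i M N) ↔
     Subsingleton (Abelian.Ext (ModuleCat.of A M) (ModuleCat.of A N) i) := by
  let R := ProjectiveResolution.of (ModuleCat.of A M)
  have h1 : Subsingleton (extMod A i M N) ↔
    Subsingleton ((R.complex.linearYonedaObj A (ModuleCat.of A N)).homology i) := 
    (R.isoExt (R := A) i (ModuleCat.of A N)).toLinearEquiv.toEquiv.subsingleton_congr
  rw [h1, subs_homology_iff]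
  have h2 : Subsingleton (Abelian.Ext (ModuleCat.of A M) (ModuleCat.of A N) i) ↔
     ∀ f : R.complex.X i ⟶ ModuleCat.of A N, R.complex.d (i+1) i ≫ f = 0 → 
      ∃ g : R.complex.X ((ComplexShape.up ℕ).prev i) ⟶ ModuleCat.of A N, R.complex.d i _ ≫ g = f := by
    cases i with
    | zero =>
      rw [Abelian.Ext.addEquiv₀.toEquiv.subsingleton_congr]
      constructor
      · intro hs f hf
        obtain ⟨l, hl⟩ := R.exact₀.desc' f hf
        refine ⟨0, ?_⟩
        have h0 : l = 0 := hs.elim _ _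
        rw [← hl, h0, Limits.comp_zero, Limits.comp_zero]
      · intro h
        refine subsingleton_of_forall_eq 0 fun g => ?_
        let g' : ((ChainComplex.single₀ (ModuleCat A)).obj (ModuleCat.of A M)).X 0 ⟶
          ModuleCat.of A N := g
        change g' = 0
        obtain ⟨u, hu⟩ := h (R.π.f 0 ≫ g')
          (by rw [← Category.assoc, R.complex_d_comp_π_f_zero, Limits.zero_comp])
        have h00 : R.complex.d 0 ((ComplexShape.up ℕ).prev 0) = 0 := by
          apply R.complex.shape
          simp
        rw [h00, Limits.zero_comp] at hu
        rw [← cancel_epi (R.π.f 0), ← hu, Limits.comp_zero]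
    | succ n =>
      have hp : (ComplexShape.up ℕ).prev (n+1) = n := by simp
      rw [hp]
      constructor
      · intro hs f hf
        exact (R.extMk_eq_zero_iff f (n+2) rfl hf n rfl).1 (hs.elim _ _)
      · intro h
        refine subsingleton_of_forall_eq 0 fun α => ?_
        obtain ⟨f, hf, rfl⟩ := R.extMk_surjective α (n+2) rfl
        exact (R.extMk_eq_zero_iff f (n+2) rfl hf n rfl).2 (h f hf)
  rw [h2]
  rfl

namespace BassAux

section general
variable {B : Type} [CommRing B]

theorem ext_mid {S : ShortComplex (ModuleCat.{0} B)} (hS : S.ShortExact) (Y : ModuleCat.{0} B) (n : ℕ)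
    (h1 : Subsingleton (Abelian.Ext S.X₁ Y n)) (h3 : Subsingleton (Abelian.Ext S.X₃ Y n)) :
    Subsingleton (Abelian.Ext S.X₂ Y n) := by
  refine subsingleton_of_forall_eq 0 fun x => ?_
  obtain ⟨y, rfl⟩ := Abelian.Ext.contravariant_sequence_exact₂ hS Y x (h1.elim _ _)
  rw [h3.elim y 0, Abelian.Ext.comp_zero]

theorem ext_left {S : ShortComplex (ModuleCat.{0} B)} (hS : S.ShortExact) (Y : ModuleCat.{0} B) (n : ℕ)
    (h2 : Subsingleton (Abelian.Ext S.X₂ Y n)) (h3 : Subsingleton (Abelian.Ext S.X₃ Y (n+1))) :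
    Subsingleton (Abelian.Ext S.X₁ Y n) := by
  refine subsingleton_of_forall_eq 0 fun x => ?_
  obtain ⟨y, rfl⟩ := Abelian.Ext.contravariant_sequence_exact₁ hS Y x (add_comm 1 n) (h3.elim _ _)
  rw [h2.elim y 0, Abelian.Ext.comp_zero]

theorem ext_right {S : ShortComplex (ModuleCat.{0} B)} (hS : S.ShortExact) (Y : ModuleCat.{0} B) (n : ℕ)
    (h1 : Subsingleton (Abelian.Ext S.X₁ Y n)) (h2 : Subsingleton (Abelian.Ext S.X₂ Y (n+1))) :
    Subsingleton (Abelian.Ext S.X₃ Y (n+1)) := by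
  refine subsingleton_of_forall_eq 0 fun x => ?_
  obtain ⟨y, rfl⟩ := Abelian.Ext.contravariant_sequence_exact₃ hS Y x (h2.elim _ _) (add_comm 1 n)
  rw [h1.elim y 0, Abelian.Ext.comp_zero]

theorem ext_iso_left {X X' : ModuleCat.{0} B} (e : X ≃ₗ[B] X') (Y : ModuleCat.{0} B) (n : ℕ)
    (h : Subsingleton (Abelian.Ext X Y n)) : Subsingleton (Abelian.Ext X' Y n) := by
  refine subsingleton_of_forall_eq 0 fun x => ?_
  have : x = (Abelian.Ext.mk₀ e.toModuleIso.inv).comp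
      ((Abelian.Ext.mk₀ e.toModuleIso.hom).comp x (zero_add n)) (zero_add n) := by
    rw [Abelian.Ext.mk₀_comp_mk₀_assoc, Iso.inv_hom_id, Abelian.Ext.mk₀_id_comp]
  rw [this, h.elim ((Abelian.Ext.mk₀ e.toModuleIso.hom).comp x (zero_add n)) 0, 
    Abelian.Ext.comp_zero]

theorem ext_zero_left (X : ModuleCat.{0} B) [Subsingleton X] (Y : ModuleCat.{0} B) (n : ℕ) :
    Subsingleton (Abelian.Ext X Y n) := by
  refine subsingleton_of_forall_eq 0 fun x => ?_
  have : 𝟙 X = 0 := by ext a; exact Subsingleton.elim _ _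
  rw [← x.mk₀_id_comp, this, Abelian.Ext.mk₀_zero, Abelian.Ext.zero_comp]

theorem ext_zero_right (X : ModuleCat.{0} B) (Y : ModuleCat.{0} B) [Subsingleton Y] (n : ℕ) :
    Subsingleton (Abelian.Ext X Y n) := by
  refine subsingleton_of_forall_eq 0 fun x => ?_
  have : 𝟙 Y = 0 := by ext a; exact Subsingleton.elim _ _
  rw [← x.comp_mk₀_id, this, Abelian.Ext.mk₀_zero, Abelian.Ext.comp_zero]

theorem smul_ext_eq_zero {X Y : ModuleCat.{0} B} {n : ℕ} {r : B} (hr : r ∈ Module.annihilator B X)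
    (α : Abelian.Ext X Y n) : r • α = 0 := by
  have h : r • 𝟙 X = 0 := by
    ext a
    exact Module.mem_annihilator.1 hr a
  have : r • α = (Abelian.Ext.mk₀ (r • 𝟙 X)).comp α (zero_add n) := by
    simp [Abelian.Ext.mk₀_smul]
  rw [this, h, Abelian.Ext.mk₀_zero, Abelian.Ext.zero_comp]

end general

section loc
variable {B : Type} [CommRing B] [IsLocalRing B] [IsNoetherianRing B]

theorem ext_nak (X Y : ModuleCat.{0} B) [Module.Finite B X] [Module.Finite B Y] (n : ℕ) (x : B)
    (hx : x ∈ IsLocalRing.maximalIdeal B) (hreg : IsSMulRegular X x)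
    (h : Subsingleton (Abelian.Ext (ModuleCat.of B (QuotSMulTop x X)) Y (n+1))) :
    Subsingleton (Abelian.Ext X Y n) := by
  have hS := hreg.smulShortComplex_shortExact
  have hsurj : ∀ α : Abelian.Ext X Y n, ∃ β : Abelian.Ext X Y n, x • β = α := by
    intro α
    obtain ⟨y, hy⟩ : ∃ y : Abelian.Ext X Y n, 
        (Abelian.Ext.mk₀ (x • 𝟙 X)).comp y (zero_add n) = α :=
      Abelian.Ext.contravariant_sequence_exact₁ hS Y α (add_comm 1 n) (h.elim _ _)
    refine ⟨y, ?_⟩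
    rw [← hy, Abelian.Ext.mk₀_smul, Abelian.Ext.smul_comp, Abelian.Ext.mk₀_id_comp]
  have htop : (⊤ : Submodule B (Abelian.Ext X Y n)) = ⊥ := by
    refine Submodule.eq_bot_of_le_smul_of_le_jacobson_bot (IsLocalRing.maximalIdeal B) ⊤
      Module.Finite.fg_top ?_ (IsLocalRing.maximalIdeal_le_jacobson _)
    intro α _
    obtain ⟨β, rfl⟩ := hsurj α
    exact Submodule.smul_mem_smul hx trivial
  exact (Submodule.subsingleton_iff B).1 (subsingleton_of_bot_eq_top htop.symm)

/-- residue field as an object -/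
noncomputable abbrev kk (B : Type) [CommRing B] [IsLocalRing B] : ModuleCat.{0} B :=
  ModuleCat.of B (IsLocalRing.ResidueField B)

theorem ext_vanish_aux (Y : ModuleCat.{0} B) [Module.Finite B Y] (t : ℕ)
    (h : ∀ i, t ≤ i → Subsingleton (Abelian.Ext (kk B) Y i)) (I : Ideal B) :
    ∀ (X : Type) [AddCommGroup X] [Module B X] [Module.Finite B X], I ≤ Module.annihilator B X →
      ∀ i, t ≤ i → Subsingleton (Abelian.Ext (ModuleCat.of B X) Y i) := by
  induction I using WellFoundedGT.induction with
  | ind I IH =>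
  intro X _ _ hXf
  induction hXf using IsNoetherianRing.induction_on_isQuotientEquivQuotientPrime B with
  | subsingleton N => 
    intro _ i _
    exact ext_zero_left _ _ _
  | quotient N p e =>
    intro hI i hi
    by_cases hp : p.1 = IsLocalRing.maximalIdeal B
    · have e' : (B ⧸ p.1) ≃ₗ[B] IsLocalRing.ResidueField B := Submodule.quotEquivOfEq _ _ hp
      exact ext_iso_left (X := kk B) (X' := ModuleCat.of B N) (e.trans e').symm Y i (h i hi)
    · have hlt : p.1 < IsLocalRing.maximalIdeal B := 
        lt_of_le_of_ne (IsLocalRing.le_maximalIdeal p.2.ne_top) hp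
      obtain ⟨x, hxm, hxp⟩ := SetLike.exists_of_lt hlt
      have hann : Module.annihilator B N = p.1 := by
        rw [e.annihilator_eq, Ideal.annihilator_quotient]
      have hreg : IsSMulRegular N x := by
        have hp := p.2
        rw [isSMulRegular_iff_right_eq_zero_of_smul]
        intro n hn
        have h1 : x • e n = 0 := by rw [← map_smul, hn, map_zero]
        obtain ⟨b, hb⟩ := Ideal.Quotient.mk_surjective (e n)
        rw [← hb, ← Ideal.Quotient.mk_eq_mk, ← Submodule.Quotient.mk_smul, 
          Submodule.Quotient.mk_eq_zero] at h1
        have := (hp.mem_or_mem h1).resolve_left hxp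
        rw [← Ideal.Quotient.eq_zero_iff_mem, hb] at this
        simpa using this
      refine ext_nak (ModuleCat.of B N) Y i x hxm hreg ?_
      refine IH (I ⊔ Ideal.span {x}) ?_ (QuotSMulTop x N) ?_ (i+1) (by omega)
      · refine lt_of_le_of_ne le_sup_left fun heq => hxp ?_
        rw [← hann]
        apply hI
        rw [heq]
        exact Ideal.mem_sup_right (Ideal.mem_span_singleton_self x)
      · refine sup_le (hI.trans ?_) ?_
        · exact LinearMap.annihilator_le_of_surjective (Submodule.mkQ _) (Submodule.mkQ_surjective _)
        · rw [Ideal.span_singleton_le_iff_mem, Module.mem_annihilator]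
          intro m
          obtain ⟨m, rfl⟩ := Submodule.mkQ_surjective _ m
          exact (Submodule.Quotient.mk_eq_zero _).2
            (Submodule.smul_mem_pointwise_smul m x ⊤ trivial)
  | exact N₁ N₂ N₃ f g hf hg hfg h₁ h₃ =>
    intro hI i hi
    let S : ShortComplex (ModuleCat.{0} B) :=
      ModuleCat.shortComplexOfCompEqZero f g hfg.linearMap_comp_eq_zero
    have hS : S.ShortExact := ModuleCat.shortComplex_shortExact S hfg hf hg
    exact ext_mid hS Y i (h₁ (hI.trans (f.annihilator_le_of_injective hf)) i hi)
      (h₃ (hI.trans (g.annihilator_le_of_surjective hg)) i hi)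

theorem ext_vanish (Y : ModuleCat.{0} B) [Module.Finite B Y] (t : ℕ)
    (h : ∀ i, t ≤ i → Subsingleton (Abelian.Ext (kk B) Y i)) 
    (X : ModuleCat.{0} B) [Module.Finite B X] (i : ℕ) (hi : t ≤ i) : Subsingleton (Abelian.Ext X Y i) := 
  ext_vanish_aux Y t h ⊥ X bot_le i hi

end loc
end BassAux

namespace BassAux
section loc2
variable {B : Type} [CommRing B] [IsLocalRing B] [IsNoetherianRing B]

/-- Finite injective dimension, tested on finitely generated modules. -/
def FI (Y : ModuleCat.{0} B) : Prop :=
  ∃ n, ∀ (X : ModuleCat.{0} B), Module.Finite B X → ∀ i, n ≤ i → Subsingleton (Abelian.Ext X Y i)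

/-- Inductive property in the construction of `B` modulo a regular sequence. -/
def PP (B : Type) [CommRing B] [IsLocalRing B] (j : ℕ) (C : ModuleCat.{0} B) : Prop :=
  Module.Finite B C ∧
  (∀ Y : ModuleCat.{0} B, Module.Finite B Y → Subsingleton (Abelian.Ext C Y j) → Subsingleton Y) ∧
  (∀ (Y : ModuleCat.{0} B) (i : ℕ), j < i → Subsingleton (Abelian.Ext C Y i)) ∧
  (∀ i, (∀ i' < i, Subsingleton (Abelian.Ext (kk B) C i')) → 
    ∀ i' < i + j, Subsingleton (Abelian.Ext (kk B) (ModuleCat.of B B) i'))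

theorem ext_self_zero (Y : ModuleCat.{0} B) (h : Subsingleton (Abelian.Ext (ModuleCat.of B B) Y 0)) :
    Subsingleton Y := by
  have hs : Subsingleton (B →ₗ[B] Y) :=
    (Abelian.Ext.addEquiv₀.toEquiv.trans
      (ModuleCat.homLinearEquiv (S := B)).toEquiv).subsingleton_congr.1 h
  refine subsingleton_of_forall_eq 0 fun y => ?_
  have := LinearMap.congr_fun (hs.elim (LinearMap.toSpanSingleton B Y y) 0) 1
  simpa using this

theorem PP_zero : PP B 0 (ModuleCat.of B B) := by
  refine ⟨inferInstance, ?_, ?_, ?_⟩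
  · intro Y _ h
    exact ext_self_zero Y h
  · intro Y i hi
    obtain ⟨i, rfl⟩ := Nat.exists_eq_add_of_lt hi
    have : Projective (ModuleCat.of B B) := inferInstance
    exact Abelian.Ext.subsingleton_of_projective _ _ _
  · intro i h i' hi'
    exact h i' hi'

theorem ann_kk : Module.annihilator B (kk B) = IsLocalRing.maximalIdeal B := 
  Ideal.annihilator_quotient

theorem PP_succ (j : ℕ) (C : ModuleCat.{0} B) (h : PP B j C) 
    (hk : ¬ ∃ f : kk B →ₗ[B] C, Function.Injective f) : ∃ C', PP B (j+1) C' := by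
  obtain ⟨h1, h2, h3, h4⟩ := h
  have hs : Subsingleton (kk B →ₗ[B] C) := by
    refine subsingleton_of_forall_eq 0 fun f => ?_
    by_contra hf
    have : IsSimpleModule B (kk B) := 
      isSimpleModule_iff_quot_maximal.2 ⟨_, IsLocalRing.maximalIdeal.isMaximal B, ⟨LinearEquiv.refl _ _⟩⟩
    exact hk ⟨f, (LinearMap.injective_or_eq_zero f).resolve_right hf⟩
  have : Module.Finite B (kk B) := inferInstance
  obtain ⟨x, hx, hreg⟩ := IsSMulRegular.subsingleton_linearMap_iff.1 hs
  have hxm := hx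
  rw [ann_kk] at hxm
  have hS := hreg.smulShortComplex_shortExact
  refine ⟨ModuleCat.of B (QuotSMulTop x C), ?_, ?_, ?_, ?_⟩
  · change Module.Finite B (QuotSMulTop x C)
    infer_instance
  · intro Y _ h
    exact h2 Y ‹_› (ext_nak C Y j x hxm hreg h)
  · intro Y i hi
    obtain ⟨i, rfl⟩ : ∃ i', i = i' + 1 := ⟨i-1, by omega⟩
    exact ext_right hS Y i (h3 Y i (by omega)) (h3 Y (i+1) (by omega))
  · intro i h i' hi'
    refine h4 (i+1) ?_ i' (by omega)
    intro l hl
    cases l with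
    | zero => 
      exact (Abelian.Ext.addEquiv₀.toEquiv.trans (ModuleCat.homLinearEquiv (S := B)).toEquiv).subsingleton_congr.2 hs
    | succ l =>
      refine subsingleton_of_forall_eq 0 fun α => ?_
      have h0 : α.comp (Abelian.Ext.mk₀ (x • 𝟙 C)) (add_zero (l+1)) = 0 := by
        rw [← Abelian.Ext.smul_eq_comp_mk₀]
        exact smul_ext_eq_zero hx α
      obtain ⟨β, hβ⟩ := Abelian.Ext.covariant_sequence_exact₁ (kk B) hS α h0 rfl
      have hsub : Subsingleton (Abelian.Ext (kk B) (C.smulShortComplex x).X₃ l) := h l (by omega)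
      have hβ0 : β = 0 := hsub.elim β 0
      subst hβ0
      rw [← hβ]
      exact Abelian.Ext.zero_comp (kk B) l hS.extClass (l+1) rfl

theorem exists_C (hB : FI (ModuleCat.of B B)) : ∃ d C, PP B d C ∧ 
    ∃ f : kk B →ₗ[B] C, Function.Injective f := by
  by_contra! hcon
  have hall : ∀ j, ∃ C, PP B j C := by
    intro j
    induction j with
    | zero => exact ⟨_, PP_zero⟩
    | succ j ih => 
      obtain ⟨C, hC⟩ := ih
      exact PP_succ j C hC (by simpa using hcon j C hC)
  obtain ⟨n, hn⟩ := hB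
  obtain ⟨C, h1, h2, _⟩ := hall n
  have := h2 (ModuleCat.of B B) inferInstance (hn C h1 n le_rfl)
  exact not_subsingleton B this

theorem ext_quot_vanish_of_inj {C N : ModuleCat.{0} B} (f : kk B →ₗ[B] C) (hf : Function.Injective f)
    [Module.Finite B C] (r : ℕ) 
    (hN : ∀ X : ModuleCat.{0} B, Module.Finite B X → Subsingleton (Abelian.Ext X N (r+1)))
    (hC : Subsingleton (Abelian.Ext C N r)) : Subsingleton (Abelian.Ext (kk B) N r) := by
  let S : ShortComplex (ModuleCat.{0} B) :=
    ModuleCat.shortComplexOfCompEqZero f f.range.mkQ (f.exact_map_mkQ_range.linearMap_comp_eq_zero)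
  have hS : S.ShortExact := ModuleCat.shortComplex_shortExact S f.exact_map_mkQ_range hf 
    (Submodule.mkQ_surjective _)
  refine ext_left hS N r hC (hN _ ?_)
  change Module.Finite B (C ⧸ f.range)
  infer_instance

theorem bass {d : ℕ} {C : ModuleCat.{0} B} (hC : PP B d C) (f : kk B →ₗ[B] C) 
    (hf : Function.Injective f) (N : ModuleCat.{0} B) [Module.Finite B N] [Nontrivial N] (hN : FI N) :
    Nontrivial (Abelian.Ext (kk B) N d) ∧ ∀ (X : ModuleCat.{0} B) [Module.Finite B X] (i : ℕ), d < i →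
      Subsingleton (Abelian.Ext X N i) := by
  obtain ⟨h1, h2, h3, h4⟩ := hC
  classical
  have hex : ∃ t, ∀ i, t ≤ i → Subsingleton (Abelian.Ext (kk B) N i) := by
    obtain ⟨n, hn⟩ := hN
    exact ⟨n, fun i hi => hn _ inferInstance i hi⟩
  have ht := Nat.find_spec hex
  have hmin := fun m => Nat.find_min hex (m := m)
  generalize Nat.find hex = t at ht hmin
  have hv : ∀ (X : ModuleCat.{0} B) [Module.Finite B X] (i : ℕ), t ≤ i →
      Subsingleton (Abelian.Ext X N i) := fun X _ i hi => ext_vanish N t ht X i hi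
  cases t with
  | zero =>
    exact absurd (ext_self_zero N (hv (ModuleCat.of B B) 0 le_rfl)) (not_subsingleton _)
  | succ r =>
    have hr : ¬ Subsingleton (Abelian.Ext (kk B) N r) := by
      intro hs
      refine hmin r (by omega) fun i hi => ?_
      rcases eq_or_lt_of_le hi with rfl | hlt
      · exact hs
      · exact ht i hlt
    have hrd : r ≤ d := by
      by_contra! hlt
      exact hr (ext_quot_vanish_of_inj f hf r (fun X _ => hv X _ le_rfl) (h3 N r hlt))
    have hdr : d ≤ r := by
      by_contra! hlt
      exact not_subsingleton N (h2 N inferInstance (hv C d hlt))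
    obtain rfl := le_antisymm hrd hdr
    exact ⟨not_subsingleton_iff_nontrivial.1 hr, fun X _ i hi => hv X i hi⟩
end loc2
end BassAux

namespace BassAux
section gen3
variable {B : Type} [CommRing B]

/-- finite free module -/
abbrev FF (B : Type) [CommRing B] (n : ℕ) : ModuleCat.{0} B := ModuleCat.of B (Fin n → B)

theorem comp_mk_eq_zero {X Z : ModuleCat.{0} B} {i n : ℕ} (α : Abelian.Ext X Z i) (f : Z ⟶ FF B n)
    (h : ∀ j : Fin n, α.comp (Abelian.Ext.mk₀ 
      (ModuleCat.ofHom ((LinearMap.proj j : (Fin n → B) →ₗ[B] B).comp f.hom))) (add_zero i) = 0) :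
    α.comp (Abelian.Ext.mk₀ f) (add_zero i) = 0 := by
  have hf : f = ∑ j : Fin n, 
      (ModuleCat.ofHom ((LinearMap.proj j : (Fin n → B) →ₗ[B] B).comp f.hom)) ≫
        ModuleCat.ofHom (LinearMap.single B (fun _ : Fin n => B) j) := by
    ext v l
    rw [ModuleCat.hom_sum, LinearMap.sum_apply]
    erw [Finset.sum_apply]
    simp [Pi.single_apply]
  rw [hf, Abelian.Ext.mk₀_sum, Abelian.Ext.comp_sum]
  refine Finset.sum_eq_zero fun j _ => ?_
  rw [← Abelian.Ext.mk₀_comp_mk₀, ← Abelian.Ext.comp_assoc_of_second_deg_zero, h j, 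
    Abelian.Ext.zero_comp]

theorem ext_free {X : ModuleCat.{0} B} {i : ℕ} (h : Subsingleton (Abelian.Ext X (ModuleCat.of B B) i)) (n : ℕ) :
    Subsingleton (Abelian.Ext X (FF B n) i) := by
  refine subsingleton_of_forall_eq 0 fun α => ?_
  rw [← α.comp_mk₀_id]
  exact comp_mk_eq_zero α (𝟙 _) fun j => h.elim _ _

theorem comp_free_zero {X : ModuleCat.{0} B} {i m n : ℕ} (α : Abelian.Ext X (FF B m) i) (f : FF B m ⟶ FF B n)
    (h : ∀ v j, f.hom v j ∈ Module.annihilator B X) :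
    α.comp (Abelian.Ext.mk₀ f) (add_zero i) = 0 := by
  refine comp_mk_eq_zero α f fun j => ?_
  have hf : (ModuleCat.ofHom ((LinearMap.proj j : (Fin n → B) →ₗ[B] B).comp f.hom) : FF B m ⟶ ModuleCat.of B B)
      = ∑ l : Fin m, (f.hom (Pi.single l 1) j) • 
      ModuleCat.ofHom (LinearMap.proj l : (Fin m → B) →ₗ[B] B) := by
    apply ModuleCat.hom_ext
    refine LinearMap.pi_ext' fun l => LinearMap.ext_ring ?_
    rw [ModuleCat.hom_sum]
    simp [Pi.single_apply, LinearMap.sum_apply]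
  rw [hf, Abelian.Ext.mk₀_sum, Abelian.Ext.comp_sum]
  refine Finset.sum_eq_zero fun l _ => ?_
  rw [Abelian.Ext.mk₀_smul, Abelian.Ext.comp_smul]
  exact smul_ext_eq_zero (h _ _) _

theorem min_cover [IsLocalRing B] (N : Type) [AddCommGroup N] [Module B N] [Module.Finite B N] :
    ∃ (n : ℕ) (f : (Fin n → B) →ₗ[B] N), Function.Surjective f ∧ 
      ∀ v, f v = 0 → ∀ j, v j ∈ IsLocalRing.maximalIdeal B := by
  classical
  have hex : ∃ n, ∃ f : (Fin n → B) →ₗ[B] N, Function.Surjective f := Module.Finite.exists_fin' B N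
  obtain ⟨f, hf⟩ := Nat.find_spec hex
  have hmin := fun m => Nat.find_min hex (m := m)
  generalize Nat.find hex = n at f hf hmin
  refine ⟨n, f, hf, fun v hv j => ?_⟩
  by_contra hj
  rw [IsLocalRing.mem_maximalIdeal, mem_nonunits_iff, not_not] at hj
  obtain ⟨u, hu⟩ := hj
  cases n with
  | zero => exact j.elim0
  | succ n =>
    refine hmin n (by omega) ⟨Fintype.linearCombination B (fun l => f (Pi.single (j.succAbove l) 1)), ?_⟩
    intro y
    obtain ⟨w, rfl⟩ := hf y
    let w' := w - (w j * (↑u⁻¹ : B)) • v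
    have hw' : f w' = f w := by simp [w', hv]
    have hw0 : w' j = 0 := by simp [w', ← hu]
    refine ⟨fun l => w' (j.succAbove l), ?_⟩
    rw [← hw', Fintype.linearCombination_apply]
    conv_rhs => rw [pi_eq_sum_univ' w', map_sum, Fin.sum_univ_succAbove _ j, hw0]
    simp

theorem ext_cov1 {S : ShortComplex (ModuleCat.{0} B)} (hS : S.ShortExact) (X : ModuleCat.{0} B) (n : ℕ)
    (h3 : Subsingleton (Abelian.Ext X S.X₃ n)) (h2 : Subsingleton (Abelian.Ext X S.X₂ (n+1))) :
    Subsingleton (Abelian.Ext X S.X₁ (n+1)) := by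
  refine subsingleton_of_forall_eq 0 fun x => ?_
  obtain ⟨y, rfl⟩ := Abelian.Ext.covariant_sequence_exact₁ X hS x (h2.elim _ _) rfl
  rw [h3.elim y 0, Abelian.Ext.zero_comp]

theorem ext_cov3 {S : ShortComplex (ModuleCat.{0} B)} (hS : S.ShortExact) (X : ModuleCat.{0} B) (n : ℕ)
    (h2 : Subsingleton (Abelian.Ext X S.X₂ n)) (h1 : Subsingleton (Abelian.Ext X S.X₁ (n+1))) :
    Subsingleton (Abelian.Ext X S.X₃ n) := by
  refine subsingleton_of_forall_eq 0 fun x => ?_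
  obtain ⟨y, rfl⟩ := Abelian.Ext.covariant_sequence_exact₃ X hS x rfl (h1.elim _ _)
  rw [h2.elim y 0, Abelian.Ext.zero_comp]

theorem ext_cov2 {S : ShortComplex (ModuleCat.{0} B)} (hS : S.ShortExact) (X : ModuleCat.{0} B) (n : ℕ)
    (h1 : Subsingleton (Abelian.Ext X S.X₁ n)) (h3 : Subsingleton (Abelian.Ext X S.X₃ n)) :
    Subsingleton (Abelian.Ext X S.X₂ n) := by
  refine subsingleton_of_forall_eq 0 fun x => ?_
  obtain ⟨y, rfl⟩ := Abelian.Ext.covariant_sequence_exact₂ X hS x (h3.elim _ _)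
  rw [h1.elim y 0, Abelian.Ext.zero_comp]
end gen3

section loc3
variable {B : Type} [CommRing B] [IsLocalRing B] [IsNoetherianRing B]

theorem cover (hB : FI (ModuleCat.of B B)) (N : ModuleCat.{0} B) [Module.Finite B N] (hN : FI N) :
    ∃ (n : ℕ) (N' : ModuleCat.{0} B) (f : N' ⟶ FF B n) (g : FF B n ⟶ N) (w : f ≫ g = 0),
      Module.Finite B N' ∧ FI N' ∧ (ShortComplex.mk f g w).ShortExact ∧
      ∀ x j, f.hom x j ∈ IsLocalRing.maximalIdeal B := by
  obtain ⟨n, p, hp, hm⟩ := min_cover (B := B) N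
  have hS := LinearMap.shortExact_shortComplexKer hp
  refine ⟨n, ModuleCat.of B p.ker, ModuleCat.ofHom p.ker.subtype, ModuleCat.ofHom p, 
    p.shortComplexKer.zero, inferInstanceAs (Module.Finite B p.ker), ?_, hS, ?_⟩
  · obtain ⟨a, ha⟩ := hN
    obtain ⟨b, hb⟩ := hB
    refine ⟨max a b + 1, fun X hX i hi => ?_⟩
    obtain ⟨i, rfl⟩ : ∃ i', i = i' + 1 := ⟨i-1, by omega⟩
    exact ext_cov1 hS X i (ha X hX i (by omega)) (ext_free (hb X hX (i+1) (by omega)) n)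
  · rintro ⟨x, hx⟩ j
    exact hm x hx j

theorem nogap (hB : FI (ModuleCat.of B B)) {d : ℕ} {C : ModuleCat.{0} B} (hC : PP B d C) 
    (f : kk B →ₗ[B] C) (hf : Function.Injective f) (r : ℕ) : 
    ∀ (N : ModuleCat.{0} B) [Module.Finite B N] (_ : FI N) (i : ℕ), i + r + 1 = d →
      Nontrivial (Abelian.Ext (kk B) N i) → Nontrivial (Abelian.Ext (kk B) N (i+1)) := by
  have hlow : ∀ i n, i < d → Subsingleton (Abelian.Ext (kk B) (FF B n) i) := fun i n hi =>
    ext_free (hC.2.2.2 0 (fun _ h => absurd h (Nat.not_lt_zero _)) i (by omega)) n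
  induction r with
  | zero =>
    intro N _ hN i hi hnt
    obtain rfl : i + 1 = d := hi
    have : Nontrivial N := by
      rw [← not_subsingleton_iff_nontrivial]
      intro h
      exact (not_subsingleton_iff_nontrivial.2 hnt) (ext_zero_right _ _ _)
    exact (bass hC f hf N hN).1
  | succ r ih =>
    intro N _ hN i hi hnt
    obtain ⟨n, N', ι, π, w, hfin, hFI, hS, hmax⟩ := cover hB N hN
    have h1 : Nontrivial (Abelian.Ext (kk B) N' (i+1)) := by
      rw [← not_subsingleton_iff_nontrivial] at hnt ⊢
      exact fun h => hnt (ext_cov3 hS (kk B) i (hlow i n (by omega)) h)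
    have h2 := ih N' hFI (i+1) (by omega) h1
    have hz : ∀ α : Abelian.Ext (kk B) N' (i+2), 
        α.comp (Abelian.Ext.mk₀ ι) (add_zero _) = 0 := by
      intro α
      by_cases hd : i + 2 < d
      · exact (hlow (i+2) n hd).elim _ _
      · obtain ⟨m, N'', ι', π', w', hfin', hFI', hS', hmax'⟩ := cover hB N' hFI
        have hs : Subsingleton (Abelian.Ext (kk B) N'' (i+2+1)) := by
          rcases subsingleton_or_nontrivial N'' with h | h
          · exact ext_zero_right _ _ _
          · exact (bass hC f hf N'' hFI').2 _ _ (by omega)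
        obtain ⟨β, rfl⟩ := Abelian.Ext.covariant_sequence_exact₃ (kk B) hS' α rfl (hs.elim _ _)
        rw [Abelian.Ext.comp_assoc_of_second_deg_zero, Abelian.Ext.mk₀_comp_mk₀]
        refine comp_free_zero β _ fun v j => ?_
        rw [ann_kk]
        exact hmax _ j
    rw [← not_subsingleton_iff_nontrivial] at h2 ⊢
    intro hs
    refine h2 (subsingleton_of_forall_eq 0 fun α => ?_)
    obtain ⟨β, rfl⟩ := Abelian.Ext.covariant_sequence_exact₁ (kk B) hS α (hz α) rfl
    rw [hs.elim β 0, Abelian.Ext.zero_comp]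

end loc3
end BassAux

namespace BassAux
section gen4
variable {B : Type} [CommRing B] [IsNoetherianRing B]

theorem lemG (n : ℕ) : ∀ (N : ModuleCat.{0} B), (∀ X : ModuleCat.{0} B, Module.Finite B X → 
    Subsingleton (Abelian.Ext X N (n+1))) → HasInjectiveDimensionLE N n := by
  induction n with
  | zero =>
    intro N h
    simp only [HasInjectiveDimensionLE, zero_add, ← injective_iff_hasInjectiveDimensionLT_one,
      ← Module.injective_iff_injective_object B N, ← Module.Baer.iff_injective]
    intro I g
    let S : ShortComplex (ModuleCat.{0} B) :=
      ModuleCat.shortComplexOfCompEqZero I.subtype I.mkQ (LinearMap.exact_subtype_mkQ I).linearMap_comp_eq_zero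
    have hS : S.ShortExact := ModuleCat.shortComplex_shortExact S (LinearMap.exact_subtype_mkQ I)
      I.injective_subtype (Submodule.mkQ_surjective _)
    have hs : Subsingleton (Abelian.Ext S.X₃ N (0+1)) := h _ (inferInstanceAs (Module.Finite B (B ⧸ I)))
    obtain ⟨φ, hφ⟩ := Abelian.Ext.contravariant_sequence_exact₁ hS N
      (Abelian.Ext.mk₀ (ModuleCat.ofHom g : S.X₁ ⟶ N)) (add_comm 1 0) (hs.elim _ _)
    obtain ⟨φ, rfl⟩ := Abelian.Ext.homEquiv₀.symm.surjective φ
    have h2 : S.f ≫ φ = ModuleCat.ofHom g := Abelian.Ext.homEquiv₀.symm.injective (by simpa using hφ)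
    refine ⟨φ.hom, fun x hx => ?_⟩
    exact LinearMap.congr_fun (congrArg ModuleCat.Hom.hom h2) ⟨x, hx⟩
  | succ n ih =>
    intro N h
    let ⟨J, _, f, _⟩ := EnoughInjectives.presentation N
    have injf : Function.Injective f.hom := (ModuleCat.mono_iff_injective f).mp ‹_›
    let S : ShortComplex (ModuleCat.{0} B) :=
      ModuleCat.shortComplexOfCompEqZero _ _ f.hom.exact_map_mkQ_range.linearMap_comp_eq_zero
    have exactS : S.ShortExact := ModuleCat.shortComplex_shortExact S
      f.hom.exact_map_mkQ_range injf (Submodule.mkQ_surjective _)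
    refine (exactS.hasInjectiveDimensionLT_X₃_iff n inferInstance).1 (ih S.X₃ fun X hX => ?_)
    refine ext_cov3 exactS X (n+1) ?_ (h X hX)
    refine subsingleton_of_forall_eq 0 fun x => ?_
    have : Injective S.X₂ := ‹Injective J›
    exact Abelian.Ext.eq_zero_of_injective x

theorem loc_FI (P : Ideal B) [P.IsPrime] (M : Type) [AddCommGroup M] [Module B M] (n : ℕ)
    (h : HasInjectiveDimensionLE (ModuleCat.of B M) n) :
    HasInjectiveDimensionLE (ModuleCat.of (Localization.AtPrime P) (LocalizedModule P.primeCompl M)) n := by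
  have h1 := ModuleCat.localizedModule_hasInjectiveDimensionLE n P.primeCompl (ModuleCat.of B M)
  refine (ModuleCat.hasInjectiveDimensionLE_iff_of_linearEquiv ?_ n).1 h1
  exact Shrink.linearEquiv (Localization.AtPrime P) (LocalizedModule P.primeCompl M)

theorem loc_FI_self (P : Ideal B) [P.IsPrime] (n : ℕ)
    (h : HasInjectiveDimensionLE (ModuleCat.of B B) n) :
    HasInjectiveDimensionLE (ModuleCat.of (Localization.AtPrime P) (Localization.AtPrime P)) n := by
  refine (ModuleCat.hasInjectiveDimensionLE_iff_of_linearEquiv ?_ n).1 (loc_FI P B n h)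
  exact (IsLocalizedModule.linearEquiv P.primeCompl (LocalizedModule.mkLinearMap P.primeCompl B)
    (Algebra.linearMap B (Localization.AtPrime P))).extendScalarsOfIsLocalization P.primeCompl (Localization.AtPrime P)

theorem FI_of_dim [IsLocalRing B] (N : ModuleCat.{0} B) (n : ℕ) (h : HasInjectiveDimensionLE N n) : FI N :=
  ⟨n+1, fun X _ i hi => HasInjectiveDimensionLT.subsingleton N (n+1) i hi X⟩
end gen4

theorem main_aux {B : Type} [CommRing B] [IsNoetherianRing B] [IsLocalRing B] 
    (hB : FI (ModuleCat.of B B)) (N : ModuleCat.{0} B) [Module.Finite B N] [Nontrivial N] (hN : FI N) :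
    ∃ d, HasInjectiveDimensionLE N d ∧ ∀ j i, j ≤ i → i ≤ d → Nontrivial (Abelian.Ext (kk B) N j) → 
      Nontrivial (Abelian.Ext (kk B) N i) := by
  obtain ⟨d, C, hC, f, hf⟩ := exists_C hB
  refine ⟨d, lemG d N fun X hX => (bass hC f hf N hN).2 X (d+1) (by omega), ?_⟩
  intro j i hji
  induction i, hji using Nat.le_induction with
  | base => exact fun _ h => h
  | succ i hi ih =>
    intro hd h
    exact nogap hB hC f hf (d - i - 1) N hN i (by omega) (ih (by omega) h)
end BassAux

theorem BassAux.dim_of_injDim (A : Type) [CommRing A] (M : Type) [AddCommGroup M] [Module A M]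
    (h : injDim A M ≠ ⊤) : ∃ n, HasInjectiveDimensionLE (ModuleCat.of A M) n := by
  unfold injDim at h
  have hne : { n : ℕ∞ | ∀ (X : Type) (_ : AddCommGroup X) (_ : Module A X) (i : ℕ),
      n < i → Subsingleton (extMod A i X M) }.Nonempty := by
    rw [Set.nonempty_iff_ne_empty]
    intro he
    rw [he, sInf_empty] at h
    exact h rfl
  have hmem := csInf_mem hne
  obtain ⟨n, hn⟩ := ENat.ne_top_iff_exists.1 h
  rw [← hn] at hmem
  refine ⟨n, HasInjectiveDimensionLT.mk fun i hi Y e => ?_⟩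
  have hs := (bridge A i Y M).1 (hmem Y _ _ i (by exact_mod_cast hi))
  exact hs.elim _ _

theorem BassAux.nontriv_iff (A : Type) [CommRing A] (i : ℕ) (M N : Type) [AddCommGroup M]
    [Module A M] [AddCommGroup N] [Module A N] :
    Nontrivial (extMod A i M N) ↔
     Nontrivial (Abelian.Ext (ModuleCat.of A M) (ModuleCat.of A N) i) := by
  rw [← not_subsingleton_iff_nontrivial, ← not_subsingleton_iff_nontrivial, bridge]

/-- Let `A` be a commutative Noetherian local Gorenstein ring, `M` a
finitely generated `A`-module of finite injective dimension, and `P` a prime in the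
support of `M`.  Then the Bass numbers satisfy: `μ^i(P,M) ≠ 0`, i.e.
`Ext^i_{A_P}(κ(P), M_P) ≠ 0`, if and only if `depth M_P ≤ i ≤ injdim M_P`. -/
theorem bass_numbers_nonzero_iff (A : Type) [CommRing A] [IsNoetherianRing A]
    [IsLocalRing A] (hGor : injDim A A ≠ ⊤)
    (M : Type) [AddCommGroup M] [Module A M] [Module.Finite A M]
    (hM : injDim A M ≠ ⊤)
    (P : Ideal A) [P.IsPrime] (hsupp : Nontrivial (LocalizedModule P.primeCompl M))
    (i : ℕ) :
    Nontrivial (extMod (Localization.AtPrime P) i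
        (IsLocalRing.ResidueField (Localization.AtPrime P))
        (LocalizedModule P.primeCompl M)) ↔
      depthLocal (Localization.AtPrime P) (LocalizedModule P.primeCompl M) ≤ i ∧
        (i : ℕ∞) ≤ injDim (Localization.AtPrime P) (LocalizedModule P.primeCompl M) := by
  obtain ⟨a, ha⟩ := BassAux.dim_of_injDim A A hGor
  obtain ⟨m, hm⟩ := BassAux.dim_of_injDim A M hM
  have hB := BassAux.FI_of_dim _ a (BassAux.loc_FI_self P a ha)
  have hN := BassAux.FI_of_dim _ m (BassAux.loc_FI P M m hm)
  have hfin : Module.Finite (Localization.AtPrime P) (LocalizedModule P.primeCompl M) :=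
    Module.Finite.of_isLocalizedModule P.primeCompl (LocalizedModule.mkLinearMap P.primeCompl M)
  have hnoeth : IsNoetherianRing (Localization.AtPrime P) :=
    IsLocalization.isNoetherianRing P.primeCompl _ inferInstance
  obtain ⟨d, hd, hgap⟩ := BassAux.main_aux hB
    (ModuleCat.of (Localization.AtPrime P) (LocalizedModule P.primeCompl M)) hN
  constructor
  · intro h
    refine ⟨sInf_le ⟨i, rfl, h⟩, le_sInf fun n hn => ?_⟩
    by_contra! hlt
    exact (not_subsingleton_iff_nontrivial.2 h) (hn _ _ _ i hlt)
  · rintro ⟨h1, h2⟩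
    have hne : { i : ℕ∞ | ∃ j : ℕ, i = j ∧ Nontrivial (extMod (Localization.AtPrime P) j
        (IsLocalRing.ResidueField (Localization.AtPrime P))
        (LocalizedModule P.primeCompl M)) }.Nonempty := by
      rw [Set.nonempty_iff_ne_empty]
      intro he
      unfold depthLocal at h1
      rw [he, sInf_empty] at h1
      exact absurd h1 (by simp)
    obtain ⟨j, hj, hnt⟩ := csInf_mem hne
    have hji : j ≤ i := by
      have h3 : (j : ℕ∞) ≤ i := hj ▸ h1
      exact_mod_cast h3
    have hid : i ≤ d := by
      have h3 : injDim (Localization.AtPrime P) (LocalizedModule P.primeCompl M) ≤ d := by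
        refine sInf_le fun X _ _ l hl => ?_
        rw [bridge]
        exact HasInjectiveDimensionLT.subsingleton _ (d+1) l (by exact_mod_cast hl) _
      exact_mod_cast h2.trans h3
    rw [BassAux.nontriv_iff] at hnt ⊢
    exact hgap j i hji hid hnt
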